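/- Let Ω ⊂ ℝ² be a bounded, open, simply connected domain satisfying Assumption (R), and let ψ₀ be the scalar potential of B. If ψ₀ does not change sign in Ω (i.e. either ψ₀ < 0 throughout Ω or ψ₀ > 0 throughout Ω), then lim_{h→0⁺} h·log Λ^D(h,B,Ω) = −2·Osc_Ω ψ₀, where Osc_Ω ψ₀ := sup_Ω ψ₀ − inf_Ω ψ₀. -/

import Mathlib

open MeasureTheory Set Filter Topology

noncomputable section

/-- First partial derivative (in the direction `x₁`) of a function on `ℝ × ℝ`. -/
def pd1 {E : Type*} [NormedAddCommGroup E] [NormedSpace ℝ E] (u : ℝ × ℝ → E) (x : ℝ × ℝ) : E :=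
  fderiv ℝ u x (1, 0)

/-- Second partial derivative (in the direction `x₂`) of a function on `ℝ × ℝ`. -/
def pd2 {E : Type*} [NormedAddCommGroup E] [NormedSpace ℝ E] (u : ℝ × ℝ → E) (x : ℝ × ℝ) : E :=
  fderiv ℝ u x (0, 1)

/-- The Laplacian on `ℝ × ℝ`. -/
def lap (ψ : ℝ × ℝ → ℝ) (x : ℝ × ℝ) : ℝ := pd1 (pd1 ψ) x + pd2 (pd2 ψ) x

/-- Test functions for the Dirichlet variational problems on `Ω`:
nonzero smooth compactly supported functions with support in `Ω`. -/
def IsTestFun (Ω : Set (ℝ × ℝ)) (u : ℝ × ℝ → ℂ) : Prop :=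
  ContDiff ℝ (⊤ : ℕ∞) u ∧ HasCompactSupport u ∧ tsupport u ⊆ Ω ∧ u ≠ 0

/-- Rayleigh quotient of the spin-`σ` (`σ = -1` : spin-down, `σ = 1` : spin-up)
Dirichlet Pauli operator at the test function `u`. -/
def pauliRayleigh (σ : ℝ) (h : ℝ) (A : ℝ × ℝ → ℝ × ℝ) (B : ℝ × ℝ → ℝ) (Ω : Set (ℝ × ℝ))
    (u : ℝ × ℝ → ℂ) : ℝ :=
  ((∫ x in Ω, (‖(h : ℂ) * pd1 u x - Complex.I * ((A x).1 : ℂ) * u x‖ ^ 2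
      + ‖(h : ℂ) * pd2 u x - Complex.I * ((A x).2 : ℂ) * u x‖ ^ 2))
    + σ * (h * ∫ x in Ω, B x * ‖u x‖ ^ 2)) / ∫ x in Ω, ‖u x‖ ^ 2

/-- The ground state energy `λ₋^D(h,A,B,Ω)` of the spin-down Dirichlet Pauli operator. -/
def lambdaMinusD (h : ℝ) (A : ℝ × ℝ → ℝ × ℝ) (B : ℝ × ℝ → ℝ) (Ω : Set (ℝ × ℝ)) : ℝ :=
  sInf (pauliRayleigh (-1) h A B Ω '' {u | IsTestFun Ω u})

/-- The ground state energy `λ₊^D(h,A,B,Ω)` of the spin-up Dirichlet Pauli operator. -/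
def lambdaPlusD (h : ℝ) (A : ℝ × ℝ → ℝ × ℝ) (B : ℝ × ℝ → ℝ) (Ω : Set (ℝ × ℝ)) : ℝ :=
  sInf (pauliRayleigh 1 h A B Ω '' {u | IsTestFun Ω u})

/-- The ground state energy `Λ^D(h,A,B,Ω)` of the full Dirichlet Pauli operator. -/
def LambdaD (h : ℝ) (A : ℝ × ℝ → ℝ × ℝ) (B : ℝ × ℝ → ℝ) (Ω : Set (ℝ × ℝ)) : ℝ :=
  min (lambdaMinusD h A B Ω) (lambdaPlusD h A B Ω)

/-- The canonical vector potential `∇⊥ψ = (−∂₂ψ, ∂₁ψ)`. -/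
def perpGrad (ψ : ℝ × ℝ → ℝ) (x : ℝ × ℝ) : ℝ × ℝ := (-(pd2 ψ x), pd1 ψ x)

/-- `ψ` is the scalar potential of `B` on `Ω`: `ψ ∈ C⁰(closure Ω) ∩ C²(Ω)`,
`Δψ = B` in `Ω` and `ψ = 0` on `∂Ω`. -/
structure IsScalarPotential (Ω : Set (ℝ × ℝ)) (B : ℝ × ℝ → ℝ) (ψ : ℝ × ℝ → ℝ) : Prop where
  contOn : ContinuousOn ψ (closure Ω)
  c2 : ContDiffOn ℝ 2 ψ Ω
  lap_eq : ∀ x ∈ Ω, lap ψ x = B x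
  bdry : ∀ x ∈ frontier Ω, ψ x = 0

/-- `A` is a continuous vector potential for `B` on `Ω`: `∂₁A₂ − ∂₂A₁ = B`. -/
def IsVectorPotential (Ω : Set (ℝ × ℝ)) (B : ℝ × ℝ → ℝ) (A : ℝ × ℝ → ℝ × ℝ) : Prop :=
  ContinuousOn A Ω ∧ ∀ x ∈ Ω, pd1 (fun y => (A y).2) x - pd2 (fun y => (A y).1) x = B x

/-- `γ` is a regular curve of class `C^{2,α}` on the parameter set `s`. -/
def C2HolderOn (α : ℝ) (γ : ℝ → ℝ × ℝ) (s : Set ℝ) : Prop :=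
  ContDiffOn ℝ 2 γ s ∧
  (∃ C : ℝ, ∀ x ∈ s, ∀ y ∈ s,
      ‖derivWithin (derivWithin γ s) s x - derivWithin (derivWithin γ s) s y‖ ≤ C * |x - y| ^ α) ∧
  ∀ x ∈ s, derivWithin γ s x ≠ 0

/-- Near `p`, the set `Γ` is a regular curve of class `C^{2,α}`. -/
def IsLocallyC2CurveAt (α : ℝ) (Γ : Set (ℝ × ℝ)) (p : ℝ × ℝ) : Prop :=
  ∃ ε > 0, ∃ γ : ℝ → ℝ × ℝ, C2HolderOn α γ (Icc (-1) 1) ∧ γ 0 = p ∧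
    Γ ∩ Metric.ball p ε = γ '' Ioo (-1) 1 ∩ Metric.ball p ε

/-- `Γ` is (locally) a regular curve of class `C^{2,α}`. -/
def IsC2HolderSet (α : ℝ) (Γ : Set (ℝ × ℝ)) : Prop := ∀ p ∈ Γ, IsLocallyC2CurveAt α Γ p

/-- `Ω` has a corner at `p` formed by two `C^{2,α}` arcs, of aperture less than `π`
(near `p`, `Ω` is contained in a strictly convex open cone with vertex `p`). -/
def HasConvexCornerAt (Ω : Set (ℝ × ℝ)) (α : ℝ) (p : ℝ × ℝ) : Prop :=
  ∃ ε > 0, (∃ γ₁ γ₂ : ℝ → ℝ × ℝ, C2HolderOn α γ₁ (Icc 0 1) ∧ C2HolderOn α γ₂ (Icc 0 1) ∧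
      γ₁ 0 = p ∧ γ₂ 0 = p ∧
      frontier Ω ∩ Metric.ball p ε = (γ₁ '' Ico 0 1 ∪ γ₂ '' Ico 0 1) ∩ Metric.ball p ε) ∧
    ∃ w : ℝ × ℝ, ∃ c > 0, ∀ x ∈ Ω ∩ Metric.ball p ε,
      c * ‖x - p‖ ≤ (x - p).1 * w.1 + (x - p).2 * w.2

/-- `Ω` has a continuous boundary which is piecewise of class `C^{2,α}` for some `α > 0`,
with at most finitely many corners, each of aperture less than `π`. -/
def HasPiecewiseC2Boundary (Ω : Set (ℝ × ℝ)) : Prop :=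
  ∃ α > 0, ∃ S : Finset (ℝ × ℝ), ↑S ⊆ frontier Ω ∧
    (∀ p ∈ frontier Ω \ (S : Set (ℝ × ℝ)), IsLocallyC2CurveAt α (frontier Ω) p) ∧
    ∀ p ∈ S, HasConvexCornerAt Ω α p

/-- Assumption (R): `Ω` is bounded and open with continuous, piecewise `C^{2,α}` boundary
having finitely many corners of aperture `< π`, and `B` extends continuously to `closure Ω`. -/
structure AssumptionR (Ω : Set (ℝ × ℝ)) (B : ℝ × ℝ → ℝ) : Prop where
  isOpen : IsOpen Ω
  bounded : Bornology.IsBounded Ω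
  bdryReg : HasPiecewiseC2Boundary Ω
  fieldCont : ContinuousOn B (closure Ω)

/-- The oscillation of `ψ` over `Ω`. -/
def osc (ψ : ℝ × ℝ → ℝ) (Ω : Set (ℝ × ℝ)) : ℝ := sSup (ψ '' Ω) - sInf (ψ '' Ω)

/-- The region enclosed by `Γ`: the union of the bounded connected components of `Γᶜ`. -/
def curveInterior (Γ : Set (ℝ × ℝ)) : Set (ℝ × ℝ) :=
  {x | x ∉ Γ ∧ Bornology.IsBounded (connectedComponentIn Γᶜ x)}

/-- `Γ` is a simple closed curve of class `C^{2,α}`. -/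
def IsC2ClosedCurve (α : ℝ) (Γ : Set (ℝ × ℝ)) : Prop :=
  ∃ γ : ℝ → ℝ × ℝ, Function.Periodic γ 1 ∧ C2HolderOn α γ (Icc 0 1) ∧
    InjOn γ (Ico 0 1) ∧ Γ = γ '' Icc 0 1

/-- The ground state energy `λ^D(Ω)` of the Dirichlet Laplacian on `Ω`. -/
def dirichletGSE (Ω : Set (ℝ × ℝ)) : ℝ :=
  sInf ((fun u : ℝ × ℝ → ℝ =>
      (∫ x in Ω, (pd1 u x ^ 2 + pd2 u x ^ 2)) / ∫ x in Ω, u x ^ 2) ''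
    {u | ContDiff ℝ (⊤ : ℕ∞) u ∧ HasCompactSupport u ∧ tsupport u ⊆ Ω ∧ u ≠ 0})

/-- The open disc of radius `R` centred at the origin (with the Euclidean distance). -/
def disc (R : ℝ) : Set (ℝ × ℝ) := {y : ℝ × ℝ | y.1 ^ 2 + y.2 ^ 2 < R ^ 2}

end


section CompactSupport

variable {E : Type*} [NormedAddCommGroup E] [NormedSpace ℝ E]

theorem ContDiff.continuous_fderiv_apply_const {f : ℝ × ℝ → E} (hf : ContDiff ℝ 1 f)
    (v : ℝ × ℝ) : Continuous fun x => fderiv ℝ f x v :=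
  (hf.continuous_fderiv one_ne_zero).clm_apply continuous_const

theorem ContDiff.continuous_pd1 {f : ℝ × ℝ → E} (hf : ContDiff ℝ 1 f) : Continuous (pd1 f) :=
  hf.continuous_fderiv_apply_const _

theorem ContDiff.continuous_pd2 {f : ℝ × ℝ → E} (hf : ContDiff ℝ 1 f) : Continuous (pd2 f) :=
  hf.continuous_fderiv_apply_const _

theorem ContDiff.pd1_of_two {f : ℝ × ℝ → E} (hf : ContDiff ℝ 2 f) : ContDiff ℝ 1 (pd1 f) :=
  (hf.fderiv_right (m := 1) (by norm_num)).clm_apply contDiff_const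

theorem ContDiff.pd2_of_two {f : ℝ × ℝ → E} (hf : ContDiff ℝ 2 f) : ContDiff ℝ 1 (pd2 f) :=
  (hf.fderiv_right (m := 1) (by norm_num)).clm_apply contDiff_const

theorem pd1_pd2_comm {f : ℝ × ℝ → E} (hf : ContDiff ℝ 2 f) (x : ℝ × ℝ) :
    pd1 (pd2 f) x = pd2 (pd1 f) x := by
  have hd : DifferentiableAt ℝ (fderiv ℝ f) x :=
    (hf.fderiv_right (m := 1) (by norm_num)).differentiable one_ne_zero x
  have key : ∀ v w : ℝ × ℝ, fderiv ℝ (fun y => fderiv ℝ f y v) x w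
      = fderiv ℝ (fderiv ℝ f) x w v := by
    intro v w
    rw [fderiv_clm_apply hd (differentiableAt_const v)]
    simp
  have hs : IsSymmSndFDerivAt ℝ f x := hf.contDiffAt.isSymmSndFDerivAt (by simp)
  exact (key _ _).trans ((hs _ _).trans (key _ _).symm)

theorem pd1_eq_zero_of_notMem_tsupport {f : ℝ × ℝ → E} {x : ℝ × ℝ} (hx : x ∉ tsupport f) :
    pd1 f x = 0 := by
  simp [pd1, fderiv_of_notMem_tsupport ℝ hx]

theorem pd2_eq_zero_of_notMem_tsupport {f : ℝ × ℝ → E} {x : ℝ × ℝ} (hx : x ∉ tsupport f) :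
    pd2 f x = 0 := by
  simp [pd2, fderiv_of_notMem_tsupport ℝ hx]

theorem integrable_of_continuous_of_eq_zero {f : ℝ × ℝ → ℝ} {K : Set (ℝ × ℝ)}
    (hf : Continuous f) (hK : IsCompact K) (h0 : ∀ x, x ∉ K → f x = 0) : Integrable f :=
  hf.integrable_of_hasCompactSupport (HasCompactSupport.intro hK h0)

theorem integral_fderiv_apply_eq_zero {f : ℝ × ℝ → ℝ} (hf : ContDiff ℝ 1 f)
    (hc : HasCompactSupport f) (v : ℝ × ℝ) : ∫ x, fderiv ℝ f x v = 0 := by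
  have hi : Integrable fun x => fderiv ℝ f x v :=
    integrable_of_continuous_of_eq_zero (hf.continuous_fderiv_apply_const v) hc
      fun x hx => by simp [fderiv_of_notMem_tsupport ℝ hx]
  have hif : Integrable f := hf.continuous.integrable_of_hasCompactSupport hc
  have := integral_mul_fderiv_eq_neg_fderiv_mul_of_integrable (μ := volume)
    (f := fun _ : ℝ × ℝ => (1 : ℝ)) (g := f) (v := v) (by simp) (by simpa using hi)
    (by simpa using hif) (fun x _ => differentiableAt_const _)
    (fun x _ => hf.differentiable one_ne_zero x)
  simpa using this

end CompactSupport

section Derivatives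

theorem pd1_mul {f g : ℝ × ℝ → ℝ} (hf : ContDiff ℝ 1 f) (hg : ContDiff ℝ 1 g) (x : ℝ × ℝ) :
    pd1 (fun y => f y * g y) x = f x * pd1 g x + g x * pd1 f x := by
  have := fderiv_fun_mul (hf.differentiable one_ne_zero x) (hg.differentiable one_ne_zero x)
  simp [pd1, this]

theorem pd2_mul {f g : ℝ × ℝ → ℝ} (hf : ContDiff ℝ 1 f) (hg : ContDiff ℝ 1 g) (x : ℝ × ℝ) :
    pd2 (fun y => f y * g y) x = f x * pd2 g x + g x * pd2 f x := by
  have := fderiv_fun_mul (hf.differentiable one_ne_zero x) (hg.differentiable one_ne_zero x)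
  simp [pd2, this]

theorem pd1_add {f g : ℝ × ℝ → ℝ} (hf : ContDiff ℝ 1 f) (hg : ContDiff ℝ 1 g) (x : ℝ × ℝ) :
    pd1 (fun y => f y + g y) x = pd1 f x + pd1 g x := by
  have := fderiv_fun_add (hf.differentiable one_ne_zero x) (hg.differentiable one_ne_zero x)
  simp [pd1, this]

theorem pd2_add {f g : ℝ × ℝ → ℝ} (hf : ContDiff ℝ 1 f) (hg : ContDiff ℝ 1 g) (x : ℝ × ℝ) :
    pd2 (fun y => f y + g y) x = pd2 f x + pd2 g x := by
  have := fderiv_fun_add (hf.differentiable one_ne_zero x) (hg.differentiable one_ne_zero x)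
  simp [pd2, this]

theorem pd1_sub {f g : ℝ × ℝ → ℝ} (hf : ContDiff ℝ 1 f) (hg : ContDiff ℝ 1 g) (x : ℝ × ℝ) :
    pd1 (fun y => f y - g y) x = pd1 f x - pd1 g x := by
  have := fderiv_fun_sub (hf.differentiable one_ne_zero x) (hg.differentiable one_ne_zero x)
  simp [pd1, this]

theorem pd2_sub {f g : ℝ × ℝ → ℝ} (hf : ContDiff ℝ 1 f) (hg : ContDiff ℝ 1 g) (x : ℝ × ℝ) :
    pd2 (fun y => f y - g y) x = pd2 f x - pd2 g x := by
  have := fderiv_fun_sub (hf.differentiable one_ne_zero x) (hg.differentiable one_ne_zero x)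
  simp [pd2, this]

theorem fderiv_re_apply {u : ℝ × ℝ → ℂ} (hu : ContDiff ℝ 1 u) (x v : ℝ × ℝ) :
    fderiv ℝ (fun y => (u y).re) x v = (fderiv ℝ u x v).re := by
  have := (Complex.reCLM.hasFDerivAt.comp x (hu.differentiable one_ne_zero x).hasFDerivAt).fderiv
  exact congrArg (fun L => L v) this

theorem fderiv_im_apply {u : ℝ × ℝ → ℂ} (hu : ContDiff ℝ 1 u) (x v : ℝ × ℝ) :
    fderiv ℝ (fun y => (u y).im) x v = (fderiv ℝ u x v).im := by
  have := (Complex.imCLM.hasFDerivAt.comp x (hu.differentiable one_ne_zero x).hasFDerivAt).fderiv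
  exact congrArg (fun L => L v) this

end Derivatives

/-- The weighted Cauchy–Riemann operator
`h (∂₁ + i s ∂₂) u + s ((∂₁ + i s ∂₂) ψ) u = h e^{-sψ/h} (∂₁ + i s ∂₂) (e^{sψ/h} u)`. -/
noncomputable def twistedDbar (s h : ℝ) (ψ : ℝ × ℝ → ℝ) (u : ℝ × ℝ → ℂ) (x : ℝ × ℝ) : ℂ :=
  (h : ℂ) * (pd1 u x + Complex.I * s * pd2 u x)
    + s * (((pd1 ψ x : ℝ) : ℂ) + Complex.I * s * ((pd2 ψ x : ℝ) : ℂ)) * u x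

/-- The Pauli quadratic form with field `Δψ` and potential `∇⊥ψ`, on the whole plane. -/
theorem integral_twistedDbar_sq {ψ : ℝ × ℝ → ℝ} {u : ℝ × ℝ → ℂ} {s : ℝ} (hs : s = 1 ∨ s = -1) (h : ℝ)
    (hψ : ContDiff ℝ 2 ψ) (hu : ContDiff ℝ 2 u) (hc : HasCompactSupport u) :
    (∫ x, (‖(h : ℂ) * pd1 u x - Complex.I * ((perpGrad ψ x).1 : ℂ) * u x‖ ^ 2
      + ‖(h : ℂ) * pd2 u x - Complex.I * ((perpGrad ψ x).2 : ℂ) * u x‖ ^ 2))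
      - s * (h * ∫ x, lap ψ x * ‖u x‖ ^ 2)
      = ∫ x, ‖twistedDbar s h ψ u x‖ ^ 2 := by
  have hu1 : ContDiff ℝ 1 u := hu.of_le (by norm_num)
  have hψ1 : ContDiff ℝ 1 ψ := hψ.of_le (by norm_num)
  have ha : ContDiff ℝ 2 fun y => (u y).re := Complex.reCLM.contDiff.comp hu
  have hb : ContDiff ℝ 2 fun y => (u y).im := Complex.imCLM.contDiff.comp hu
  set a : ℝ × ℝ → ℝ := fun y => (u y).re with ha_def
  set b : ℝ × ℝ → ℝ := fun y => (u y).im with hb_def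
  have ha1 : ContDiff ℝ 1 a := ha.of_le (by norm_num)
  have hb1 : ContDiff ℝ 1 b := hb.of_le (by norm_num)
  have hpa1 := ha.pd1_of_two
  have hpa2 := ha.pd2_of_two
  have hpb1 := hb.pd1_of_two
  have hpb2 := hb.pd2_of_two
  have hp1 := hψ.pd1_of_two
  have hp2 := hψ.pd2_of_two
  have h_zero : ∀ x, x ∉ tsupport u → u x = 0 := fun x hx => image_eq_zero_of_notMem_tsupport hx
  let F : ℝ × ℝ → ℝ := fun y => h * (b y * pd2 a y - a y * pd2 b y)
    + pd1 ψ y * (a y * a y + b y * b y)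
  let G : ℝ × ℝ → ℝ := fun y => h * (b y * pd1 a y - a y * pd1 b y)
    - pd2 ψ y * (a y * a y + b y * b y)
  have hF : ContDiff ℝ 1 F := by fun_prop
  have hG : ContDiff ℝ 1 G := by fun_prop
  have hFc : HasCompactSupport F := HasCompactSupport.intro hc fun x hx => by
    simp [F, a, b, h_zero x hx]
  have hGc : HasCompactSupport G := HasCompactSupport.intro hc fun x hx => by
    simp [G, a, b, h_zero x hx]
  have hF0 : ∫ x, pd1 F x = 0 := integral_fderiv_apply_eq_zero hF hFc _
  have hG0 : ∫ x, pd2 G x = 0 := integral_fderiv_apply_eq_zero hG hGc _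
  have hFi : Integrable (pd1 F) := hF.continuous_pd1.integrable_of_hasCompactSupport
    (HasCompactSupport.intro hFc fun x hx => pd1_eq_zero_of_notMem_tsupport hx)
  have hGi : Integrable (pd2 G) := hG.continuous_pd2.integrable_of_hasCompactSupport
    (HasCompactSupport.intro hGc fun x hx => pd2_eq_zero_of_notMem_tsupport hx)
  have hc1 := hu1.continuous_pd1
  have hc2 := hu1.continuous_pd2
  have hcp1 := hψ1.continuous_pd1
  have hcp2 := hψ1.continuous_pd2
  have hcu := hu.continuous
  have hTi : Integrable fun x =>
      ‖(h : ℂ) * pd1 u x - Complex.I * ((perpGrad ψ x).1 : ℂ) * u x‖ ^ 2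
      + ‖(h : ℂ) * pd2 u x - Complex.I * ((perpGrad ψ x).2 : ℂ) * u x‖ ^ 2 := by
    refine integrable_of_continuous_of_eq_zero (K := tsupport u) ?_ hc fun x hx => ?_
    · simp only [perpGrad]; fun_prop
    · simp [h_zero x hx, pd1_eq_zero_of_notMem_tsupport hx, pd2_eq_zero_of_notMem_tsupport hx]
  have hBi : Integrable fun x => lap ψ x * ‖u x‖ ^ 2 := by
    refine integrable_of_continuous_of_eq_zero (K := tsupport u) ?_ hc fun x hx => ?_
    · have := hp1.continuous_pd1
      have := hp2.continuous_pd2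
      unfold lap; fun_prop
    · simp [h_zero x hx]
  have hpt : ∀ x, ‖twistedDbar s h ψ u x‖ ^ 2
      = (‖(h : ℂ) * pd1 u x - Complex.I * ((perpGrad ψ x).1 : ℂ) * u x‖ ^ 2
      + ‖(h : ℂ) * pd2 u x - Complex.I * ((perpGrad ψ x).2 : ℂ) * u x‖ ^ 2)
      - s * (h * (lap ψ x * ‖u x‖ ^ 2)) + s * (h * (pd1 F x - pd2 G x)) := by
    intro x
    have e1 : (pd1 u x).re = pd1 a x := (fderiv_re_apply hu1 x _).symm
    have e2 : (pd2 u x).re = pd2 a x := (fderiv_re_apply hu1 x _).symm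
    have e3 : (pd1 u x).im = pd1 b x := (fderiv_im_apply hu1 x _).symm
    have e4 : (pd2 u x).im = pd2 b x := (fderiv_im_apply hu1 x _).symm
    have hF' : pd1 F x = h * (b x * pd1 (pd2 a) x + pd2 a x * pd1 b x
        - (a x * pd1 (pd2 b) x + pd2 b x * pd1 a x))
        + (pd1 ψ x * (2 * a x * pd1 a x + 2 * b x * pd1 b x)
          + (a x * a x + b x * b x) * pd1 (pd1 ψ) x) := by
      have h1 : ContDiff ℝ 1 fun y => h * (b y * pd2 a y - a y * pd2 b y) := by fun_prop
      have h2 : ContDiff ℝ 1 fun y => a y * a y + b y * b y := by fun_prop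
      have h3 : ContDiff ℝ 1 fun y => b y * pd2 a y - a y * pd2 b y := by fun_prop
      rw [pd1_add h1 (hp1.mul h2), pd1_mul contDiff_const h3,
        pd1_sub (hb1.mul hpa2) (ha1.mul hpb2), pd1_mul hp1 h2,
        pd1_add (ha1.mul ha1) (hb1.mul hb1), pd1_mul hb1 hpa2, pd1_mul ha1 hpb2,
        pd1_mul ha1 ha1, pd1_mul hb1 hb1]
      rw [show pd1 (fun _ => h) x = 0 by simp [pd1]]
      ring
    have hG' : pd2 G x = h * (b x * pd1 (pd2 a) x + pd1 a x * pd2 b x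
        - (a x * pd1 (pd2 b) x + pd1 b x * pd2 a x))
        - (pd2 ψ x * (2 * a x * pd2 a x + 2 * b x * pd2 b x)
          + (a x * a x + b x * b x) * pd2 (pd2 ψ) x) := by
      have h1 : ContDiff ℝ 1 fun y => h * (b y * pd1 a y - a y * pd1 b y) := by fun_prop
      have h2 : ContDiff ℝ 1 fun y => a y * a y + b y * b y := by fun_prop
      have h3 : ContDiff ℝ 1 fun y => b y * pd1 a y - a y * pd1 b y := by fun_prop
      rw [pd1_pd2_comm ha, pd1_pd2_comm hb, pd2_sub h1 (hp2.mul h2), pd2_mul contDiff_const h3,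
        pd2_sub (hb1.mul hpa1) (ha1.mul hpb1), pd2_mul hp2 h2,
        pd2_add (ha1.mul ha1) (hb1.mul hb1), pd2_mul hb1 hpa1, pd2_mul ha1 hpb1,
        pd2_mul ha1 ha1, pd2_mul hb1 hb1]
      rw [show pd2 (fun _ => h) x = 0 by simp [pd2]]
      ring
    rw [hF', hG']
    simp only [twistedDbar, perpGrad, lap, Complex.sq_norm, Complex.normSq_apply]
    simp [e1, e2, e3, e4]
    rw [show (u x).re = a x from rfl, show (u x).im = b x from rfl]
    rcases hs with rfl | rfl <;> ring
  have hint : ∫ x, ‖twistedDbar s h ψ u x‖ ^ 2 = ∫ x,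
      ((‖(h : ℂ) * pd1 u x - Complex.I * ((perpGrad ψ x).1 : ℂ) * u x‖ ^ 2
      + ‖(h : ℂ) * pd2 u x - Complex.I * ((perpGrad ψ x).2 : ℂ) * u x‖ ^ 2)
      - s * (h * (lap ψ x * ‖u x‖ ^ 2)) + s * (h * (pd1 F x - pd2 G x))) :=
    integral_congr_ae (Eventually.of_forall hpt)
  have hsB : Integrable fun x => s * (h * (lap ψ x * ‖u x‖ ^ 2)) :=
    (hBi.const_mul h).const_mul s
  have hsFG : Integrable fun x => s * (h * (pd1 F x - pd2 G x)) :=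
    ((hFi.sub hGi).const_mul h).const_mul s
  rw [hint, integral_add (by exact hTi.sub hsB) hsFG, integral_sub hTi hsB]
  simp only [integral_const_mul]
  rw [integral_sub hFi hGi, hF0, hG0]
  simp

theorem twistedDbar_gauge {s h : ℝ} (hh : h ≠ 0) {ψ θ : ℝ × ℝ → ℝ} {w : ℝ × ℝ → ℂ}
    (hψ : ContDiff ℝ 1 ψ) (hθ : ContDiff ℝ 1 θ) (hw : ContDiff ℝ 1 w) (x : ℝ × ℝ) :
    twistedDbar s h ψ (fun y => Real.exp (-(s / h) * θ y) • w y) x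
      = Real.exp (-(s / h) * θ x) • twistedDbar s h (fun y => ψ y - θ y) w x := by
  have hθd := (hθ.differentiable one_ne_zero x)
  have key : ∀ v : ℝ × ℝ, fderiv ℝ (fun y => Real.exp (-(s / h) * θ y) • w y) x v
      = Real.exp (-(s / h) * θ x) • (fderiv ℝ w x v + (-(s / h) * fderiv ℝ θ x v) • w x) := by
    intro v
    have h1 : HasFDerivAt (fun y => Real.exp (-(s / h) * θ y))
        (Real.exp (-(s / h) * θ x) • (-(s / h)) • fderiv ℝ θ x) x :=
      (hθd.hasFDerivAt.const_mul (-(s / h))).exp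
    rw [(h1.fun_smul (hw.differentiable one_ne_zero x).hasFDerivAt).fderiv]
    simp [mul_assoc, smul_smul]
  have hh' : (h : ℂ) ≠ 0 := by exact_mod_cast hh
  simp only [twistedDbar, pd1_sub hψ hθ, pd2_sub hψ hθ]
  simp only [pd1, pd2, key]
  simp only [Complex.real_smul]
  push_cast
  field_simp
  ring

theorem integral_sq_norm_le_integral_sq_pd1 {v : ℝ × ℝ → ℂ} (hv : ContDiff ℝ 1 v)
    (hc : HasCompactSupport v) {R : ℝ} (hR : ∀ x ∈ tsupport v, |x.1| ≤ R) :
    ∫ x, ‖v x‖ ^ 2 ≤ 4 * R ^ 2 * ∫ x, ‖pd1 v x‖ ^ 2 := by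
  have ha : ContDiff ℝ 1 fun y => (v y).re := Complex.reCLM.contDiff.comp hv
  have hb : ContDiff ℝ 1 fun y => (v y).im := Complex.imCLM.contDiff.comp hv
  set a : ℝ × ℝ → ℝ := fun y => (v y).re with ha_def
  set b : ℝ × ℝ → ℝ := fun y => (v y).im with hb_def
  have hx1 : ContDiff ℝ 1 fun y : ℝ × ℝ => y.1 := contDiff_fst
  have h_zero : ∀ x, x ∉ tsupport v → v x = 0 := fun x hx => image_eq_zero_of_notMem_tsupport hx
  let F : ℝ × ℝ → ℝ := fun y => y.1 * (a y * a y + b y * b y)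
  have hF : ContDiff ℝ 1 F := by fun_prop
  have hFc : HasCompactSupport F := HasCompactSupport.intro hc fun x hx => by
    simp [F, a, b, h_zero x hx]
  have hF0 : ∫ x, pd1 F x = 0 := integral_fderiv_apply_eq_zero hF hFc _
  have hFi : Integrable (pd1 F) := hF.continuous_pd1.integrable_of_hasCompactSupport
    (HasCompactSupport.intro hFc fun x hx => pd1_eq_zero_of_notMem_tsupport hx)
  have hc1 := hv.continuous_pd1
  have hcv := hv.continuous
  have hvi : Integrable fun x => ‖v x‖ ^ 2 :=
    integrable_of_continuous_of_eq_zero (by fun_prop) hc fun x hx => by simp [h_zero x hx]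
  have hpi : Integrable fun x => ‖pd1 v x‖ ^ 2 :=
    integrable_of_continuous_of_eq_zero (by fun_prop) hc fun x hx => by
      simp [pd1_eq_zero_of_notMem_tsupport hx]
  have hpt : ∀ x, ‖v x‖ ^ 2 ≤ 2 * pd1 F x + 4 * R ^ 2 * ‖pd1 v x‖ ^ 2 := by
    intro x
    have e1 : (pd1 v x).re = pd1 a x := (fderiv_re_apply hv x _).symm
    have e3 : (pd1 v x).im = pd1 b x := (fderiv_im_apply hv x _).symm
    have hF' : pd1 F x = x.1 * (2 * a x * pd1 a x + 2 * b x * pd1 b x)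
        + (a x * a x + b x * b x) := by
      have h2 : ContDiff ℝ 1 fun y => a y * a y + b y * b y := by fun_prop
      rw [pd1_mul hx1 h2, pd1_add (ha.mul ha) (hb.mul hb), pd1_mul ha ha, pd1_mul hb hb]
      rw [show pd1 (fun y : ℝ × ℝ => y.1) x = 1 by simp [pd1, fderiv_fst]]
      ring
    simp only [hF', Complex.sq_norm, Complex.normSq_apply, e1, e3]
    rw [show (v x).re = a x from rfl, show (v x).im = b x from rfl]
    by_cases hx : x ∈ tsupport v
    · have hR2 : x.1 ^ 2 ≤ R ^ 2 := sq_le_sq' (abs_le.mp (hR x hx)).1 (abs_le.mp (hR x hx)).2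
      have hmul := mul_le_mul_of_nonneg_right hR2
        (add_nonneg (sq_nonneg (pd1 a x)) (sq_nonneg (pd1 b x)))
      nlinarith [sq_nonneg (a x + 2 * x.1 * pd1 a x), sq_nonneg (b x + 2 * x.1 * pd1 b x)]
    · rw [show a x = 0 by simp [a, h_zero x hx], show b x = 0 by simp [b, h_zero x hx]]
      nlinarith [mul_nonneg (sq_nonneg R)
        (add_nonneg (sq_nonneg (pd1 a x)) (sq_nonneg (pd1 b x)))]
  calc ∫ x, ‖v x‖ ^ 2 ≤ ∫ x, (2 * pd1 F x + 4 * R ^ 2 * ‖pd1 v x‖ ^ 2) :=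
        integral_mono hvi ((hFi.const_mul 2).add (hpi.const_mul _)) hpt
    _ = 4 * R ^ 2 * ∫ x, ‖pd1 v x‖ ^ 2 := by
        rw [integral_add (hFi.const_mul 2) (hpi.const_mul _), integral_const_mul,
          integral_const_mul, hF0]
        simp

theorem integrable_twistedDbar_sq {ψ : ℝ × ℝ → ℝ} {u : ℝ × ℝ → ℂ} (s h : ℝ)
    (hψ : ContDiff ℝ 1 ψ) (hu : ContDiff ℝ 1 u) (hc : HasCompactSupport u) :
    Integrable fun x => ‖twistedDbar s h ψ u x‖ ^ 2 := by
  have hc1 := hu.continuous_pd1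
  have hc2 := hu.continuous_pd2
  have hp1 := hψ.continuous_pd1
  have hp2 := hψ.continuous_pd2
  have hcu := hu.continuous
  refine integrable_of_continuous_of_eq_zero (by unfold twistedDbar; fun_prop) hc fun x hx => ?_
  simp [twistedDbar, image_eq_zero_of_notMem_tsupport hx, pd1_eq_zero_of_notMem_tsupport hx,
    pd2_eq_zero_of_notMem_tsupport hx]

theorem integral_sq_norm_le_integral_twistedDbar_zero {v : ℝ × ℝ → ℂ} {s : ℝ}
    (hs : s = 1 ∨ s = -1) (h : ℝ) (hv : ContDiff ℝ 2 v) (hc : HasCompactSupport v) {R : ℝ}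
    (hR : ∀ x ∈ tsupport v, |x.1| ≤ R) :
    h ^ 2 * ∫ x, ‖v x‖ ^ 2 ≤ 4 * R ^ 2 * ∫ x, ‖twistedDbar s h (fun _ => 0) v x‖ ^ 2 := by
  have hv1 : ContDiff ℝ 1 v := hv.of_le (by norm_num)
  have hc1 := hv1.continuous_pd1
  have hc2 := hv1.continuous_pd2
  have hid := integral_twistedDbar_sq hs h (contDiff_const (c := (0 : ℝ))) hv hc
  have hP := integral_sq_norm_le_integral_sq_pd1 hv1 hc hR
  have hpi : Integrable fun x => ‖pd1 v x‖ ^ 2 :=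
    integrable_of_continuous_of_eq_zero (by fun_prop) hc fun x hx => by
      simp [pd1_eq_zero_of_notMem_tsupport hx]
  have hpi2 : Integrable fun x => ‖pd2 v x‖ ^ 2 :=
    integrable_of_continuous_of_eq_zero (by fun_prop) hc fun x hx => by
      simp [pd2_eq_zero_of_notMem_tsupport hx]
  have hle : h ^ 2 * ∫ x, ‖pd1 v x‖ ^ 2 ≤ ∫ x, ‖twistedDbar s h (fun _ => 0) v x‖ ^ 2 := by
    rw [← hid]
    have hz1 : pd1 (fun _ : ℝ × ℝ => (0 : ℝ)) = fun _ => 0 := by funext x; simp [pd1]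
    have hz2 : pd2 (fun _ : ℝ × ℝ => (0 : ℝ)) = fun _ => 0 := by funext x; simp [pd2]
    simp only [perpGrad, lap, hz1, hz2, neg_zero, Complex.ofReal_zero, mul_zero, zero_mul, sub_zero,
      add_zero, integral_zero, norm_mul, mul_pow, Complex.norm_real, Real.norm_eq_abs, sq_abs]
    rw [← integral_const_mul]
    refine integral_mono (hpi.const_mul _) ((hpi.const_mul _).add (hpi2.const_mul _)) fun x => ?_
    exact le_add_of_nonneg_right (by positivity)
  calc h ^ 2 * ∫ x, ‖v x‖ ^ 2 ≤ h ^ 2 * (4 * R ^ 2 * ∫ x, ‖pd1 v x‖ ^ 2) := by gcongr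
    _ = 4 * R ^ 2 * (h ^ 2 * ∫ x, ‖pd1 v x‖ ^ 2) := by ring
    _ ≤ _ := by gcongr

/-- Ground state lower bound: the twisted Cauchy–Riemann operator is bounded below by the
exponential of the oscillation of its weight. -/
theorem integral_sq_norm_le_integral_twistedDbar {ψ : ℝ × ℝ → ℝ} {u : ℝ × ℝ → ℂ} {s h : ℝ}
    (hs : s = 1 ∨ s = -1) (hh : 0 < h) (hψ : ContDiff ℝ 2 ψ) (hu : ContDiff ℝ 2 u)
    (hc : HasCompactSupport u) {R m M : ℝ} (hR : ∀ x ∈ tsupport u, |x.1| ≤ R)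
    (hm : ∀ x ∈ tsupport u, m ≤ s * ψ x) (hM : ∀ x ∈ tsupport u, s * ψ x ≤ M) :
    h ^ 2 * ∫ x, ‖u x‖ ^ 2
      ≤ 4 * R ^ 2 * Real.exp (2 * (M - m) / h) * ∫ x, ‖twistedDbar s h ψ u x‖ ^ 2 := by
  let v : ℝ × ℝ → ℂ := fun y => Real.exp (s / h * ψ y) • u y
  have hv : ContDiff ℝ 2 v := by fun_prop
  have hts : tsupport v ⊆ tsupport u := closure_mono fun x hx hx0 => hx (by simp [v, hx0])
  have hvc : HasCompactSupport v := HasCompactSupport.intro hc fun x hx => by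
    simp [v, image_eq_zero_of_notMem_tsupport hx]
  have huv : u = fun y => Real.exp (-(s / h) * ψ y) • v y := by
    funext y
    simp [v, ← Complex.exp_add, ← mul_assoc]
  have hψ1 : ContDiff ℝ 1 ψ := hψ.of_le (by norm_num)
  have hv1 : ContDiff ℝ 1 v := hv.of_le (by norm_num)
  have hD : ∀ x, twistedDbar s h ψ u x
      = Real.exp (-(s / h) * ψ x) • twistedDbar s h (fun _ => 0) v x := by
    intro x
    have := twistedDbar_gauge (s := s) hh.ne' hψ1 hψ1 hv1 x
    rw [← huv] at this
    simpa using this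
  have hP := integral_sq_norm_le_integral_twistedDbar_zero hs h hv hvc fun x hx => hR x (hts hx)
  have hui : Integrable fun x => ‖u x‖ ^ 2 :=
    integrable_of_continuous_of_eq_zero (by have := hu.continuous; fun_prop) hc fun x hx => by
      simp [image_eq_zero_of_notMem_tsupport hx]
  have hvi : Integrable fun x => ‖v x‖ ^ 2 :=
    integrable_of_continuous_of_eq_zero (by have := hv.continuous; fun_prop) hvc fun x hx => by
      simp [image_eq_zero_of_notMem_tsupport hx]
  have h1 : ∫ x, ‖u x‖ ^ 2 ≤ Real.exp (-(2 * m / h)) * ∫ x, ‖v x‖ ^ 2 := by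
    rw [← integral_const_mul]
    refine integral_mono hui (hvi.const_mul _) fun x => ?_
    by_cases hx : x ∈ tsupport u
    · have : ‖u x‖ ^ 2 = Real.exp (-(2 * (s * ψ x) / h)) * ‖v x‖ ^ 2 := by
        conv_lhs => rw [huv]
        rw [norm_smul, mul_pow, Real.norm_eq_abs, Real.abs_exp, ← Real.exp_nat_mul]
        congr 2
        push_cast
        ring
      rw [this]
      have := hm x hx
      gcongr
    · simp only [image_eq_zero_of_notMem_tsupport hx, norm_zero, zero_pow two_ne_zero]
      positivity
  have h2 : ∫ x, ‖twistedDbar s h (fun _ => 0) v x‖ ^ 2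
      ≤ Real.exp (2 * M / h) * ∫ x, ‖twistedDbar s h ψ u x‖ ^ 2 := by
    rw [← integral_const_mul]
    refine integral_mono (integrable_twistedDbar_sq s h contDiff_const hv1 hvc)
      ((integrable_twistedDbar_sq s h hψ1 (hu.of_le (by norm_num)) hc).const_mul _) fun x => ?_
    by_cases hx : x ∈ tsupport u
    · have : ‖twistedDbar s h (fun _ => 0) v x‖ ^ 2
          = Real.exp (2 * (s * ψ x) / h) * ‖twistedDbar s h ψ u x‖ ^ 2 := by
        rw [hD, norm_smul, mul_pow, Real.norm_eq_abs, Real.abs_exp, ← Real.exp_nat_mul,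
          ← mul_assoc, ← Real.exp_add]
        rw [show 2 * (s * ψ x) / h + ((2 : ℕ) : ℝ) * (-(s / h) * ψ x) = 0 by push_cast; ring]
        simp
      rw [this]
      have := hM x hx
      gcongr
    · have hxv : x ∉ tsupport v := fun h' => hx (hts h')
      have : twistedDbar s h (fun _ => 0) v x = 0 := by
        simp [twistedDbar, image_eq_zero_of_notMem_tsupport hxv,
          pd1_eq_zero_of_notMem_tsupport hxv, pd2_eq_zero_of_notMem_tsupport hxv]
      simp only [this, norm_zero, zero_pow two_ne_zero]
      positivity
  calc h ^ 2 * ∫ x, ‖u x‖ ^ 2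
      ≤ h ^ 2 * (Real.exp (-(2 * m / h)) * ∫ x, ‖v x‖ ^ 2) := by gcongr
    _ = Real.exp (-(2 * m / h)) * (h ^ 2 * ∫ x, ‖v x‖ ^ 2) := by ring
    _ ≤ Real.exp (-(2 * m / h)) * (4 * R ^ 2 *
        (Real.exp (2 * M / h) * ∫ x, ‖twistedDbar s h ψ u x‖ ^ 2)) := by
        refine mul_le_mul_of_nonneg_left (hP.trans ?_) (Real.exp_nonneg _)
        exact mul_le_mul_of_nonneg_left h2 (by positivity)
    _ = _ := by
        rw [show 2 * (M - m) / h = -(2 * m / h) + 2 * M / h by ring, Real.exp_add]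
        ring

theorem exists_contDiff_dist_fderiv_le {f : ℝ × ℝ → ℝ} (hf : ContDiff ℝ 1 f)
    (hc : HasCompactSupport f) {η : ℝ} (hη : 0 < η) :
    ∃ g : ℝ × ℝ → ℝ, ContDiff ℝ (⊤ : ℕ∞) g ∧ (∀ x, |g x - f x| ≤ η) ∧
      ∀ x, ‖fderiv ℝ g x - fderiv ℝ f x‖ ≤ η := by
  have hcd := hf.continuous_fderiv one_ne_zero
  obtain ⟨ε₁, hε₁, h₁⟩ := Metric.uniformContinuous_iff.mp
    (hc.uniformContinuous_of_continuous hf.continuous) η hη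
  obtain ⟨ε₂, hε₂, h₂⟩ := Metric.uniformContinuous_iff.mp
    ((hc.fderiv (𝕜 := ℝ)).uniformContinuous_of_continuous hcd) η hη
  have hε : 0 < min ε₁ ε₂ := lt_min hε₁ hε₂
  let φ : ContDiffBump (0 : ℝ × ℝ) := ⟨min ε₁ ε₂ / 2, min ε₁ ε₂, half_pos hε, half_lt_self hε⟩
  have hli : LocallyIntegrable (φ.normed volume) (volume : Measure (ℝ × ℝ)) :=
    (φ.continuous_normed (μ := volume)).locallyIntegrable
  refine ⟨_, (φ.hasCompactSupport_normed (μ := volume)).contDiff_convolution_left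
    (ContinuousLinearMap.lsmul ℝ ℝ) φ.contDiff_normed
    (hf.continuous.locallyIntegrable (μ := volume)), fun x => ?_, fun x => ?_⟩
  · rw [← Real.dist_eq]
    refine φ.dist_normed_convolution_le hf.continuous.aestronglyMeasurable fun y hy => ?_
    exact (h₁ (lt_of_lt_of_le hy (min_le_left _ _))).le
  · have hd := (hc.hasFDerivAt_convolution_right (ContinuousLinearMap.lsmul ℝ ℝ) hli hf x).fderiv
    have hL : (ContinuousLinearMap.lsmul ℝ ℝ : ℝ →L[ℝ] ℝ →L[ℝ] ℝ).precompR (ℝ × ℝ)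
        = ContinuousLinearMap.lsmul ℝ ℝ := by
      ext <;> simp
    rw [hd, hL, ← dist_eq_norm]
    refine φ.dist_normed_convolution_le hcd.aestronglyMeasurable fun y hy => ?_
    exact (h₂ (lt_of_lt_of_le hy (min_le_right _ _))).le

theorem exists_cutoff {K Ω : Set (ℝ × ℝ)} (hK : IsCompact K) (hΩ : IsOpen Ω) (hKΩ : K ⊆ Ω) :
    ∃ χ : ℝ × ℝ → ℝ, ContDiff ℝ (⊤ : ℕ∞) χ ∧ HasCompactSupport χ ∧ tsupport χ ⊆ Ω ∧
      (∀ x ∈ K, χ =ᶠ[𝓝 x] fun _ => 1) ∧ ∀ x, χ x ∈ Icc (0 : ℝ) 1 := by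
  obtain ⟨L, hL, hKL, hLΩ⟩ := exists_compact_between hK hΩ hKΩ
  obtain ⟨f, hf1, hf0, hf⟩ := exists_contMDiffMap_one_nhds_of_subset_interior
    (n := (⊤ : ℕ∞)) (modelWithCornersSelf ℝ (ℝ × ℝ)) hK.isClosed hKL
  have hts : tsupport f ⊆ L :=
    closure_minimal (fun x hx => by_contra fun hxL => hx (hf0 x hxL)) hL.isClosed
  exact ⟨f, f.contMDiff.contDiff, HasCompactSupport.intro hL hf0, hts.trans hLΩ,
    fun x hx => (eventually_nhdsSet_iff_forall.mp hf1) x hx, hf⟩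

theorem exists_contDiff_extension {K Ω : Set (ℝ × ℝ)} {ψ : ℝ × ℝ → ℝ} (hK : IsCompact K)
    (hΩ : IsOpen Ω) (hKΩ : K ⊆ Ω) (hψ : ContDiffOn ℝ 2 ψ Ω) :
    ∃ φ : ℝ × ℝ → ℝ, ContDiff ℝ 2 φ ∧ HasCompactSupport φ ∧ ∀ x ∈ K, φ =ᶠ[𝓝 x] ψ := by
  obtain ⟨χ, hχ, hχc, hχΩ, hχ1, -⟩ := exists_cutoff hK hΩ hKΩ
  have hχ2 : ContDiff ℝ 2 χ := hχ.of_le (WithTop.coe_le_coe.mpr (le_top (a := (2 : ℕ∞))))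
  refine ⟨fun x => χ x * ψ x, ?_, hχc.mul_right, fun x hx => ?_⟩
  · refine contDiff_iff_contDiffAt.mpr fun x => ?_
    by_cases hx : x ∈ tsupport χ
    · exact hχ2.contDiffAt.mul (hψ.contDiffAt (hΩ.mem_nhds (hχΩ hx)))
    · have h0 : (fun y => χ y * ψ y) =ᶠ[𝓝 x] fun _ => 0 := by
        filter_upwards [notMem_tsupport_iff_eventuallyEq.mp hx] with y hy
        simp [hy]
      exact contDiffAt_const.congr_of_eventuallyEq h0
  · filter_upwards [hχ1 x hx] with y hy
    simp [hy]

theorem pauliRayleigh_eq {Ω : Set (ℝ × ℝ)} {B ψ φ : ℝ × ℝ → ℝ} {u : ℝ × ℝ → ℂ} {s : ℝ}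
    (hs : s = 1 ∨ s = -1) (h : ℝ) (hu : IsTestFun Ω u) (hB : ∀ x ∈ Ω, lap ψ x = B x)
    (hφ : ContDiff ℝ 2 φ) (hφψ : ∀ x ∈ tsupport u, φ =ᶠ[𝓝 x] ψ) :
    pauliRayleigh (-s) h (perpGrad ψ) B Ω u
      = (∫ x, ‖twistedDbar s h φ u x‖ ^ 2) / ∫ x, ‖u x‖ ^ 2 := by
  obtain ⟨hu, hc, hΩ, -⟩ := hu
  rw [← integral_twistedDbar_sq hs h hφ (hu.of_le (WithTop.coe_le_coe.mpr (le_top (a := (2 : ℕ∞))))) hc]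
  have hnot : ∀ x, x ∉ Ω → x ∉ tsupport u := fun x hx hx' => hx (hΩ hx')
  have e1 : ∀ x ∈ tsupport u, pd1 φ x = pd1 ψ x := fun x hx => by
    simp only [pd1, (hφψ x hx).fderiv_eq]
  have e2 : ∀ x ∈ tsupport u, pd2 φ x = pd2 ψ x := fun x hx => by
    simp only [pd2, (hφψ x hx).fderiv_eq]
  have e3 : ∀ x ∈ tsupport u, lap φ x = B x := fun x hx => by
    have h1 : pd1 φ =ᶠ[𝓝 x] pd1 ψ := (hφψ x hx).fderiv (𝕜 := ℝ) |>.mono fun y hy => by simp only [pd1, hy]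
    have h2 : pd2 φ =ᶠ[𝓝 x] pd2 ψ := (hφψ x hx).fderiv (𝕜 := ℝ) |>.mono fun y hy => by simp only [pd2, hy]
    rw [← hB x (hΩ hx)]
    change fderiv ℝ (pd1 φ) x (1, 0) + fderiv ℝ (pd2 φ) x (0, 1) = _
    rw [h1.fderiv_eq, h2.fderiv_eq]
    rfl
  unfold pauliRayleigh
  rw [setIntegral_eq_integral_of_forall_compl_eq_zero, setIntegral_eq_integral_of_forall_compl_eq_zero,
    setIntegral_eq_integral_of_forall_compl_eq_zero]
  · rw [neg_mul, ← sub_eq_add_neg]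
    congr 2
    · refine integral_congr_ae (Eventually.of_forall fun x => ?_)
      by_cases hx : x ∈ tsupport u
      · simp only [perpGrad, e1 x hx, e2 x hx]
      · simp [image_eq_zero_of_notMem_tsupport hx]
    · congr 2
      refine integral_congr_ae (Eventually.of_forall fun x => ?_)
      by_cases hx : x ∈ tsupport u
      · simp only [e3 x hx]
      · simp [image_eq_zero_of_notMem_tsupport hx]
  · intro x hx
    simp [image_eq_zero_of_notMem_tsupport (hnot x hx)]
  · intro x hx
    simp [image_eq_zero_of_notMem_tsupport (hnot x hx)]
  · intro x hx
    simp [image_eq_zero_of_notMem_tsupport (hnot x hx),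
      pd1_eq_zero_of_notMem_tsupport (hnot x hx), pd2_eq_zero_of_notMem_tsupport (hnot x hx)]

theorem integral_sq_norm_pos {u : ℝ × ℝ → ℂ} (hu : Continuous u) (hc : HasCompactSupport u)
    (h0 : u ≠ 0) : 0 < ∫ x, ‖u x‖ ^ 2 := by
  obtain ⟨x, hx⟩ := Function.ne_iff.mp h0
  refine Continuous.integral_pos_of_hasCompactSupport_nonneg_nonzero (x := x) (by fun_prop)
    (HasCompactSupport.intro hc fun x hx => by simp [image_eq_zero_of_notMem_tsupport hx])
    (fun x => by positivity) ?_
  simpa using hx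

theorem le_pauliRayleigh {Ω : Set (ℝ × ℝ)} {B ψ : ℝ × ℝ → ℝ} {u : ℝ × ℝ → ℂ} {s h : ℝ}
    (hs : s = 1 ∨ s = -1) (hh : 0 < h) (hΩ : IsOpen Ω) (hψ : ContDiffOn ℝ 2 ψ Ω)
    (hB : ∀ x ∈ Ω, lap ψ x = B x) (hu : IsTestFun Ω u) {R m M : ℝ} (hR0 : 0 < R)
    (hR : ∀ x ∈ Ω, |x.1| ≤ R) (hm : ∀ x ∈ Ω, m ≤ ψ x) (hM : ∀ x ∈ Ω, ψ x ≤ M) :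
    h ^ 2 / (4 * R ^ 2) * Real.exp (-(2 * (M - m) / h))
      ≤ pauliRayleigh (-s) h (perpGrad ψ) B Ω u := by
  have hu' := hu
  obtain ⟨hu, hc, huΩ, hu0⟩ := hu
  obtain ⟨φ, hφ, -, hφψ⟩ := exists_contDiff_extension hc hΩ huΩ hψ
  rw [pauliRayleigh_eq hs h hu' hB hφ hφψ, le_div_iff₀ (integral_sq_norm_pos hu.continuous hc hu0)]
  have hval : ∀ x ∈ tsupport u, φ x = ψ x := fun x hx => (hφψ x hx).eq_of_nhds
  have hmain : h ^ 2 * ∫ x, ‖u x‖ ^ 2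
      ≤ 4 * R ^ 2 * Real.exp (2 * (M - m) / h) * ∫ x, ‖twistedDbar s h φ u x‖ ^ 2 := by
    have hu2 : ContDiff ℝ 2 u := hu.of_le (WithTop.coe_le_coe.mpr (le_top (a := (2 : ℕ∞))))
    have hRu : ∀ x ∈ tsupport u, |x.1| ≤ R := fun x hx => hR x (huΩ hx)
    rcases hs with rfl | rfl
    · exact integral_sq_norm_le_integral_twistedDbar (Or.inl rfl) hh hφ hu2 hc hRu
        (fun x hx => by rw [hval x hx, one_mul]; exact hm x (huΩ hx))
        (fun x hx => by rw [hval x hx, one_mul]; exact hM x (huΩ hx))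
    · have := integral_sq_norm_le_integral_twistedDbar (s := -1) (Or.inr rfl) hh hφ hu2 hc hRu
        (m := -M) (M := -m)
        (fun x hx => by rw [hval x hx]; linarith [hM x (huΩ hx)])
        (fun x hx => by rw [hval x hx]; linarith [hm x (huΩ hx)])
      rwa [show -m - -M = M - m by ring] at this
  rw [Real.exp_neg]
  have hE := Real.exp_pos (2 * (M - m) / h)
  set E := Real.exp (2 * (M - m) / h)
  rw [show h ^ 2 / (4 * R ^ 2) * E⁻¹ * ∫ x, ‖u x‖ ^ 2
      = (h ^ 2 * ∫ x, ‖u x‖ ^ 2) / (4 * R ^ 2 * E) by field_simp]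
  rw [div_le_iff₀ (by positivity), mul_comm (∫ x, ‖twistedDbar s h φ u x‖ ^ 2)]
  exact hmain

theorem exists_quasimode {s : ℝ} (hs : s = 1 ∨ s = -1) {φ χ : ℝ × ℝ → ℝ} (hφ : ContDiff ℝ 1 φ)
    (hφc : HasCompactSupport φ) (hχ : ContDiff ℝ (⊤ : ℕ∞) χ) (hχc : HasCompactSupport χ)
    (hχ01 : ∀ x, χ x ∈ Icc (0 : ℝ) 1) {U : Set (ℝ × ℝ)} (hU : IsOpen U) (hUχ : ∀ x ∈ U, χ x = 1)
    {L δ : ℝ} (hδ : 0 < δ)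
    (hgrad : ∀ x ∈ tsupport χ, s * φ x < -δ → fderiv ℝ χ x = 0)
    (hL : ∀ x ∈ U, s * φ x ≤ -L) :
    ∃ C > 0, ∀ h > 0, ∃ θ : ℝ × ℝ → ℝ, ContDiff ℝ (⊤ : ℕ∞) θ ∧
      ∫ x, ‖twistedDbar s h φ (fun y => Real.exp (-(s / h) * θ y) • (χ y : ℂ)) x‖ ^ 2
        ≤ C * h ^ 2 * Real.exp (4 * δ / h) ∧
      volume.real U * Real.exp (2 * (L - δ) / h)
        ≤ ∫ x, ‖Real.exp (-(s / h) * θ x) • (χ x : ℂ)‖ ^ 2 := by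
  have hχ1 : ContDiff ℝ 1 χ := hχ.of_le (by exact_mod_cast le_top)
  have hsabs : |s| = 1 := by rcases hs with rfl | rfl <;> simp
  obtain ⟨C₁, hC₁⟩ := (hχc.fderiv (𝕜 := ℝ)).exists_bound_of_continuous
    (hχ1.continuous_fderiv one_ne_zero)
  have hC₁0 : 0 ≤ C₁ := (norm_nonneg _).trans (hC₁ 0)
  obtain ⟨M, hM⟩ := hφc.exists_bound_of_continuous hφ.continuous
  have hvol : volume (tsupport χ) < ⊤ := hχc.measure_lt_top
  have hw : ContDiff ℝ (⊤ : ℕ∞) fun y => (χ y : ℂ) := Complex.ofRealCLM.contDiff.comp hχ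
  have hw1 : ContDiff ℝ 1 fun y => (χ y : ℂ) := hw.of_le (by exact_mod_cast le_top)
  have hwd : ∀ x v, fderiv ℝ (fun y => (χ y : ℂ)) x v = (fderiv ℝ χ x v : ℝ) := fun x v => by
    have := (Complex.ofRealCLM.hasFDerivAt.comp x
      (hχ1.differentiable one_ne_zero x).hasFDerivAt).fderiv
    exact congrArg (fun L => L v) this
  refine ⟨(2 * C₁ + 1) ^ 2 * volume.real (tsupport χ) + 1, by positivity, fun h hh => ?_⟩
  set η : ℝ := min δ (h * Real.exp (-((M + δ) / h)) / 2) with hη_def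
  have hη : 0 < η := lt_min hδ (by positivity)
  have hηδ : η ≤ δ := min_le_left _ _
  have hη2 : 2 * η * Real.exp ((M + δ) / h) ≤ h := by
    have : η ≤ h * Real.exp (-((M + δ) / h)) / 2 := min_le_right _ _
    calc 2 * η * Real.exp ((M + δ) / h)
        ≤ 2 * (h * Real.exp (-((M + δ) / h)) / 2) * Real.exp ((M + δ) / h) := by gcongr
      _ = h := by rw [Real.exp_neg]; field_simp
  obtain ⟨θ, hθ, hθ0, hθ1⟩ := exists_contDiff_dist_fderiv_le hφ hφc hη
  have hsθ : ∀ x, |s * θ x - s * φ x| ≤ η := fun x => by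
    rw [← mul_sub, abs_mul, hsabs, one_mul]; exact hθ0 x
  have hθ1' : ContDiff ℝ 1 θ := hθ.of_le (by exact_mod_cast le_top)
  have hexp : ∀ x, -(s / h) * θ x = -(s * θ x) / h := fun x => by ring
  have hcont : ContDiff ℝ 1 fun y => Real.exp (-(s / h) * θ y) • (χ y : ℂ) := by fun_prop
  have hcompact : HasCompactSupport fun y => Real.exp (-(s / h) * θ y) • (χ y : ℂ) :=
    HasCompactSupport.intro hχc fun x hx => by simp [image_eq_zero_of_notMem_tsupport hx]
  refine ⟨θ, hθ, ?_, ?_⟩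
  · have hb : ∀ x ∈ tsupport χ,
        ‖twistedDbar s h φ (fun y => Real.exp (-(s / h) * θ y) • (χ y : ℂ)) x‖
          ≤ (2 * C₁ + 1) * (h * Real.exp (2 * δ / h)) := by
      intro x hx
      rw [twistedDbar_gauge hh.ne' hφ hθ1' hw1, norm_smul, Real.norm_eq_abs, Real.abs_exp]
      have hop : ∀ v : ℝ × ℝ, ‖v‖ = 1 → ‖fderiv ℝ (fun y => φ y - θ y) x v‖ ≤ η := fun v hv => by
        rw [fderiv_fun_sub (hφ.differentiable one_ne_zero x) (hθ1'.differentiable one_ne_zero x)]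
        refine (ContinuousLinearMap.le_opNorm _ v).trans ?_
        rw [hv, mul_one, norm_sub_rev]
        exact hθ1 x
      have hop' : ∀ v : ℝ × ℝ, ‖v‖ = 1 → ‖fderiv ℝ χ x v‖ ≤ ‖fderiv ℝ χ x‖ := fun v hv => by
        simpa [hv] using (fderiv ℝ χ x).le_opNorm v
      have hn1 : ‖((1 : ℝ), (0 : ℝ))‖ = 1 := by simp [Prod.norm_def]
      have hn2 : ‖((0 : ℝ), (1 : ℝ))‖ = 1 := by simp [Prod.norm_def]
      have hsn : ‖(s : ℂ)‖ = 1 := by rw [Complex.norm_real, Real.norm_eq_abs, hsabs]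
      have hχn : ‖(χ x : ℂ)‖ ≤ 1 := by
        rw [Complex.norm_real, Real.norm_eq_abs, abs_of_nonneg (hχ01 x).1]; exact (hχ01 x).2
      have hT : ‖twistedDbar s h (fun y => φ y - θ y) (fun y => (χ y : ℂ)) x‖
          ≤ h * (2 * ‖fderiv ℝ χ x‖) + 2 * η := by
        unfold twistedDbar
        refine (norm_add_le _ _).trans (add_le_add ?_ ?_)
        · rw [norm_mul, Complex.norm_real, Real.norm_eq_abs, abs_of_pos hh]
          refine mul_le_mul_of_nonneg_left ((norm_add_le _ _).trans ?_) hh.le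
          rw [norm_mul, norm_mul, Complex.norm_I, hsn, pd1, pd2, hwd, hwd, Complex.norm_real,
            Complex.norm_real]
          linarith [hop' _ hn1, hop' _ hn2]
        · rw [norm_mul, norm_mul, hsn, one_mul]
          have : ‖((pd1 (fun y => φ y - θ y) x : ℝ) : ℂ)
              + Complex.I * s * ((pd2 (fun y => φ y - θ y) x : ℝ) : ℂ)‖ ≤ 2 * η := by
            refine (norm_add_le _ _).trans ?_
            rw [norm_mul, norm_mul, Complex.norm_I, hsn, Complex.norm_real, Complex.norm_real]
            have h1 := hop _ hn1
            have h2 := hop _ hn2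
            simp only [pd1, pd2]
            linarith
          calc _ ≤ 2 * η * 1 := mul_le_mul this hχn (norm_nonneg _) (by positivity)
            _ = 2 * η := mul_one _
      have hA : Real.exp (-(s / h) * θ x) * ‖fderiv ℝ χ x‖ ≤ Real.exp (2 * δ / h) * C₁ := by
        by_cases hlt : s * φ x < -δ
        · rw [hgrad x hx hlt, norm_zero, mul_zero]
          positivity
        · rw [hexp]
          refine mul_le_mul (Real.exp_le_exp.mpr ?_) (hC₁ x) (norm_nonneg _) (Real.exp_nonneg _)
          have := (abs_le.mp (hsθ x)).1
          gcongr
          linarith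
      have hBd : Real.exp (-(s / h) * θ x) * (2 * η) ≤ h * Real.exp (2 * δ / h) := by
        have h1 : Real.exp (-(s / h) * θ x) ≤ Real.exp ((M + δ) / h) := by
          rw [hexp]
          refine Real.exp_le_exp.mpr ?_
          have h2 := (abs_le.mp (hsθ x)).1
          have h3 : |s * φ x| ≤ M := by rw [abs_mul, hsabs, one_mul]; exact hM x
          have h4 := (abs_le.mp h3).1
          gcongr
          linarith
        calc Real.exp (-(s / h) * θ x) * (2 * η) ≤ Real.exp ((M + δ) / h) * (2 * η) := by gcongr
          _ = 2 * η * Real.exp ((M + δ) / h) := by ring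
          _ ≤ h * 1 := by rw [mul_one]; exact hη2
          _ ≤ h * Real.exp (2 * δ / h) := by
            gcongr
            exact Real.one_le_exp (by positivity)
      calc _ ≤ Real.exp (-(s / h) * θ x) * (h * (2 * ‖fderiv ℝ χ x‖) + 2 * η) := by gcongr
        _ = 2 * h * (Real.exp (-(s / h) * θ x) * ‖fderiv ℝ χ x‖)
            + Real.exp (-(s / h) * θ x) * (2 * η) := by ring
        _ ≤ 2 * h * (Real.exp (2 * δ / h) * C₁) + h * Real.exp (2 * δ / h) := by gcongr
        _ = _ := by ring
    rw [← setIntegral_eq_integral_of_forall_compl_eq_zero (s := tsupport χ)]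
    · refine (Real.le_norm_self _).trans ((norm_setIntegral_le_of_norm_le_const hvol
        (C := ((2 * C₁ + 1) * (h * Real.exp (2 * δ / h))) ^ 2) fun x hx => ?_).trans ?_)
      · rw [norm_pow, norm_norm]
        exact pow_le_pow_left₀ (norm_nonneg _) (hb x hx) 2
      · rw [show 4 * δ / h = 2 * δ / h + 2 * δ / h by ring, Real.exp_add]
        have : 0 ≤ h ^ 2 * (Real.exp (2 * δ / h) * Real.exp (2 * δ / h)) := by positivity
        nlinarith
    · intro x hx
      have hsub : tsupport (fun y => Real.exp (-(s / h) * θ y) • (χ y : ℂ)) ⊆ tsupport χ :=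
        closure_mono fun z hz hz0 => hz (by simp [hz0])
      have hx' := fun h' => hx (hsub h')
      rw [twistedDbar, pd1_eq_zero_of_notMem_tsupport hx', pd2_eq_zero_of_notMem_tsupport hx']
      simp [image_eq_zero_of_notMem_tsupport hx]
  · have hi : Integrable fun x => ‖Real.exp (-(s / h) * θ x) • (χ x : ℂ)‖ ^ 2 :=
      integrable_of_continuous_of_eq_zero (by have := hcont.continuous; fun_prop) hcompact
        fun x hx => by rw [image_eq_zero_of_notMem_tsupport hx]; simp
    have hUs : U ⊆ tsupport χ := fun x hx => subset_tsupport _ (by simp [hUχ x hx])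
    calc volume.real U * Real.exp (2 * (L - δ) / h)
        = ∫ _ in U, Real.exp (2 * (L - δ) / h) := by simp
      _ ≤ ∫ x in U, ‖Real.exp (-(s / h) * θ x) • (χ x : ℂ)‖ ^ 2 := by
        refine setIntegral_mono_on
          (integrableOn_const ((measure_mono hUs).trans_lt hvol).ne) hi.integrableOn
          hU.measurableSet fun x hx => ?_
        rw [hUχ x hx, norm_smul, mul_pow, Real.norm_eq_abs, Real.abs_exp, ← Real.exp_nat_mul]
        simp only [Complex.ofReal_one, norm_one, one_pow, mul_one]
        refine Real.exp_le_exp.mpr ?_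
        rw [hexp, Nat.cast_ofNat, ← mul_div_assoc]
        have := (abs_le.mp (hsθ x)).2
        have := hL x hx
        gcongr
        linarith
      _ ≤ _ := setIntegral_le_integral hi (Eventually.of_forall fun x => by positivity)

theorem tendsto_mul_log_const_mul_sq {c : ℝ} (hc : 0 < c) :
    Tendsto (fun h : ℝ => h * Real.log (c * h ^ 2)) (𝓝[>] 0) (𝓝 0) := by
  have h1 : Tendsto (fun h : ℝ => h * Real.log c + 2 * (h * Real.log h)) (𝓝[>] 0) (𝓝 0) := by
    have : Continuous fun h : ℝ => h * Real.log c + 2 * (h * Real.log h) := by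
      have := Real.continuous_mul_log
      fun_prop
    simpa using (this.tendsto 0).mono_left nhdsWithin_le_nhds
  refine h1.congr' ?_
  filter_upwards [self_mem_nhdsWithin] with h hh
  have hh : (0 : ℝ) < h := hh
  rw [Real.log_mul hc.ne' (by positivity), Real.log_pow]
  push_cast
  ring

theorem mul_log_const_mul_sq_mul_exp {c h : ℝ} (hc : 0 < c) (hh : 0 < h) (b : ℝ) :
    h * Real.log (c * h ^ 2 * Real.exp (b / h)) = h * Real.log (c * h ^ 2) + b := by
  rw [Real.log_mul (by positivity) (Real.exp_ne_zero _), Real.log_exp, mul_add,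
    mul_div_cancel₀ _ hh.ne']

theorem tendsto_mul_log_of_exp_bounds {f : ℝ → ℝ} {a c : ℝ} (hc : 0 < c)
    (hlow : ∀ h > 0, c * h ^ 2 * Real.exp (-a / h) ≤ f h)
    (hup : ∀ δ > 0, ∃ C > 0, ∀ h > 0, f h ≤ C * h ^ 2 * Real.exp ((δ - a) / h)) :
    Tendsto (fun h : ℝ => h * Real.log (f h)) (𝓝[>] 0) (𝓝 (-a)) := by
  refine tendsto_order.mpr ⟨fun b hb => ?_, fun b hb => ?_⟩
  · have ht := (tendsto_mul_log_const_mul_sq hc).add_const (-a)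
    rw [zero_add] at ht
    filter_upwards [ht.eventually (eventually_gt_nhds hb), self_mem_nhdsWithin] with h hbh hh
    have hh : 0 < h := hh
    rw [← mul_log_const_mul_sq_mul_exp hc hh] at hbh
    refine hbh.trans_le ?_
    have := hlow h hh
    gcongr
  · obtain ⟨C, hC, hCf⟩ := hup ((b + a) / 2) (by linarith)
    have ht := (tendsto_mul_log_const_mul_sq hC).add_const ((b + a) / 2 - a)
    rw [zero_add] at ht
    filter_upwards [ht.eventually (eventually_lt_nhds (b := b) (by linarith)),
      self_mem_nhdsWithin] with h hbh hh
    have hh : 0 < h := hh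
    rw [← mul_log_const_mul_sq_mul_exp hC hh] at hbh
    refine lt_of_le_of_lt ?_ hbh
    have h1 := hlow h hh
    have h2 := hCf h hh
    have h3 : 0 < f h := lt_of_lt_of_le (by positivity) h1
    gcongr

theorem le_LambdaD {Ω : Set (ℝ × ℝ)} {B ψ : ℝ × ℝ → ℝ} (hΩ : IsOpen Ω)
    (hψ : ContDiffOn ℝ 2 ψ Ω) (hB : ∀ x ∈ Ω, lap ψ x = B x) (hne : {u | IsTestFun Ω u}.Nonempty)
    {R m M h : ℝ} (hR0 : 0 < R) (hR : ∀ x ∈ Ω, |x.1| ≤ R) (hm : ∀ x ∈ Ω, m ≤ ψ x)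
    (hM : ∀ x ∈ Ω, ψ x ≤ M) (hh : 0 < h) :
    h ^ 2 / (4 * R ^ 2) * Real.exp (-(2 * (M - m) / h)) ≤ LambdaD h (perpGrad ψ) B Ω := by
  refine le_min (le_csInf (hne.image _) ?_) (le_csInf (hne.image _) ?_)
  · rintro _ ⟨u, hu, rfl⟩
    exact le_pauliRayleigh (Or.inl rfl) hh hΩ hψ hB hu hR0 hR hm hM
  · rintro _ ⟨u, hu, rfl⟩
    simpa only [neg_neg] using
      le_pauliRayleigh (s := -1) (Or.inr rfl) hh hΩ hψ hB hu hR0 hR hm hM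

theorem LambdaD_le_pauliRayleigh {Ω : Set (ℝ × ℝ)} {B ψ : ℝ × ℝ → ℝ} {u : ℝ × ℝ → ℂ}
    (hΩ : IsOpen Ω) (hψ : ContDiffOn ℝ 2 ψ Ω) (hB : ∀ x ∈ Ω, lap ψ x = B x) {R m M h s : ℝ}
    (hR0 : 0 < R) (hR : ∀ x ∈ Ω, |x.1| ≤ R) (hm : ∀ x ∈ Ω, m ≤ ψ x) (hM : ∀ x ∈ Ω, ψ x ≤ M)
    (hh : 0 < h) (hs : s = 1 ∨ s = -1) (hu : IsTestFun Ω u) :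
    LambdaD h (perpGrad ψ) B Ω ≤ pauliRayleigh (-s) h (perpGrad ψ) B Ω u := by
  have hbdd : BddBelow (pauliRayleigh (-s) h (perpGrad ψ) B Ω '' {u | IsTestFun Ω u}) := by
    refine ⟨h ^ 2 / (4 * R ^ 2) * Real.exp (-(2 * (M - m) / h)), ?_⟩
    rintro _ ⟨v, hv, rfl⟩
    exact le_pauliRayleigh hs hh hΩ hψ hB hv hR0 hR hm hM
  have hle := csInf_le hbdd (mem_image_of_mem _ hu)
  rcases hs with rfl | rfl
  · exact (min_le_left _ _).trans hle
  · refine (min_le_right _ _).trans ?_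
    rw [neg_neg] at hle ⊢
    exact hle

theorem nonempty_isTestFun {Ω : Set (ℝ × ℝ)} (hΩ : IsOpen Ω) (hne : Ω.Nonempty) :
    {u | IsTestFun Ω u}.Nonempty := by
  obtain ⟨x, hx⟩ := hne
  obtain ⟨χ, hχ, hχc, hχΩ, hχ1, -⟩ :=
    exists_cutoff isCompact_singleton hΩ (singleton_subset_iff.mpr hx)
  have hsub : tsupport (fun y => (χ y : ℂ)) ⊆ tsupport χ :=
    closure_mono fun z hz hz0 => hz (by simp [hz0])
  refine ⟨fun y => (χ y : ℂ), Complex.ofRealCLM.contDiff.comp hχ,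
    HasCompactSupport.intro hχc fun y hy => by simp [image_eq_zero_of_notMem_tsupport hy],
    hsub.trans hχΩ, fun h0 => ?_⟩
  have h1 : (χ x : ℂ) = 0 := congrFun h0 x
  simp [(hχ1 x rfl).eq_of_nhds] at h1

/-- Test functions concentrated near the minimum of `sψ` bound the ground state energy. -/
theorem exists_isTestFun_pauliRayleigh_le {Ω : Set (ℝ × ℝ)} {B ψ : ℝ × ℝ → ℝ} {s : ℝ}
    (hs : s = 1 ∨ s = -1) (hΩ : IsOpen Ω) (hbd : Bornology.IsBounded Ω)
    (hψ : IsScalarPotential Ω B ψ) (hneg : ∀ x ∈ Ω, s * ψ x < 0) {L δ : ℝ} (hδ : 0 < δ)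
    (hL : ∃ x ∈ Ω, s * ψ x < -(L - δ)) :
    ∃ C > 0, ∀ h > 0, ∃ u, IsTestFun Ω u ∧
      pauliRayleigh (-s) h (perpGrad ψ) B Ω u
        ≤ C * h ^ 2 * Real.exp ((8 * δ - 2 * L) / h) := by
  obtain ⟨x₀, hx₀, hx₀L⟩ := hL
  have hx₀0 := hneg x₀ hx₀
  set δ₁ : ℝ := min δ (-(s * ψ x₀) / 2) with hδ₁_def
  have hδ₁ : 0 < δ₁ := lt_min hδ (by linarith)
  have hδ₁δ : δ₁ ≤ δ := min_le_left _ _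
  have hx₀δ : s * ψ x₀ < -δ₁ := by
    have : δ₁ ≤ -(s * ψ x₀) / 2 := min_le_right _ _
    linarith
  have hcont : ContinuousOn (fun x => s * ψ x) (closure Ω) := continuousOn_const.mul hψ.contOn
  set K : Set (ℝ × ℝ) := closure Ω ∩ (fun x => s * ψ x) ⁻¹' Iic (-δ₁) with hK_def
  have hK : IsCompact K := hbd.isCompact_closure.of_isClosed_subset
    (hcont.preimage_isClosed_of_isClosed isClosed_closure isClosed_Iic) inter_subset_left
  have hKΩ : K ⊆ Ω := fun x hx => by
    by_contra hxΩ
    have h0 : ψ x = 0 := hψ.bdry x (by rw [hΩ.frontier_eq]; exact ⟨hx.1, hxΩ⟩)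
    have h1 : s * ψ x ≤ -δ₁ := hx.2
    rw [h0, mul_zero] at h1
    linarith
  obtain ⟨χ, hχ, hχc, hχΩ, hχ1, hχ01⟩ := exists_cutoff hK hΩ hKΩ
  obtain ⟨φ, hφ, hφc, hφψ⟩ := exists_contDiff_extension hχc hΩ hχΩ hψ.c2
  have hval : ∀ x ∈ tsupport χ, φ x = ψ x := fun x hx => (hφψ x hx).eq_of_nhds
  set U : Set (ℝ × ℝ) := Ω ∩ (fun x => s * ψ x) ⁻¹' Iio (min (-(L - δ)) (-δ₁)) with hU_def
  have hU : IsOpen U := (hcont.mono subset_closure).isOpen_inter_preimage hΩ isOpen_Iio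
  have hUK : U ⊆ K := fun x hx =>
    ⟨subset_closure hx.1, (hx.2.le.trans (min_le_right _ _) : s * ψ x ≤ -δ₁)⟩
  have hUχ : ∀ x ∈ U, χ x = 1 := fun x hx => (hχ1 x (hUK hx)).eq_of_nhds
  have hUs : U ⊆ tsupport χ := fun x hx => subset_tsupport _ (by simp [hUχ x hx])
  have hx₀U : x₀ ∈ U := ⟨hx₀, lt_min hx₀L hx₀δ⟩
  have hV : 0 < volume.real U := ENNReal.toReal_pos (hU.measure_pos volume ⟨x₀, hx₀U⟩).ne'
    ((measure_mono hUs).trans_lt hχc.measure_lt_top).ne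
  obtain ⟨C, hC, hCh⟩ := exists_quasimode hs (hφ.of_le one_le_two) hφc hχ hχc hχ01 hU hUχ
    (L := L - δ) hδ
    (fun x hx hlt => by
      rw [hval x hx] at hlt
      have hxK : x ∈ K := ⟨subset_closure (hχΩ hx), (by linarith : s * ψ x ≤ -δ₁)⟩
      rw [(hχ1 x hxK).fderiv_eq, fderiv_const_apply])
    (fun x hx => by
      rw [hval x (hUs hx)]
      exact (hx.2.le.trans (min_le_left _ _) : s * ψ x ≤ -(L - δ)))
  refine ⟨C / volume.real U, by positivity, fun h hh => ?_⟩
  obtain ⟨θ, hθ, hnum, hden⟩ := hCh h hh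
  have hsub : tsupport (fun y => Real.exp (-(s / h) * θ y) • (χ y : ℂ)) ⊆ tsupport χ :=
    closure_mono fun z hz hz0 => hz (by simp [hz0])
  have hw : ContDiff ℝ (⊤ : ℕ∞) fun y => (χ y : ℂ) := Complex.ofRealCLM.contDiff.comp hχ
  have hu : IsTestFun Ω fun y => Real.exp (-(s / h) * θ y) • (χ y : ℂ) := by
    refine ⟨by fun_prop,
      HasCompactSupport.intro hχc fun y hy => by simp [image_eq_zero_of_notMem_tsupport hy],
      hsub.trans hχΩ, fun h0 => ?_⟩
    have h1 := congrFun h0 x₀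
    simp [hUχ x₀ hx₀U] at h1
  refine ⟨_, hu, ?_⟩
  rw [pauliRayleigh_eq hs h hu hψ.lap_eq hφ fun x hx => hφψ x (hsub hx)]
  calc _ ≤ C * h ^ 2 * Real.exp (4 * δ / h)
        / (volume.real U * Real.exp (2 * (L - δ - δ) / h)) :=
        div_le_div₀ (by positivity) hnum (by positivity) hden
    _ = C / volume.real U * h ^ 2 * Real.exp ((8 * δ - 2 * L) / h) := by
      rw [show (8 * δ - 2 * L) / h = 4 * δ / h - 2 * (L - δ - δ) / h by ring, Real.exp_sub]
      field_simp

theorem exists_mul_lt_neg_osc_sub {Ω : Set (ℝ × ℝ)} {ψ : ℝ × ℝ → ℝ} {s : ℝ}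
    (hs : s = 1 ∨ s = -1) (hne : Ω.Nonempty) (hneg : ∀ x ∈ Ω, s * ψ x < 0) {δ : ℝ} (hδ : 0 < δ) :
    ∃ x ∈ Ω, s * ψ x < -(osc ψ Ω - δ) := by
  rcases hs with rfl | rfl
  · have hsup : sSup (ψ '' Ω) ≤ 0 := Real.sSup_nonpos (by
      rintro _ ⟨x, hx, rfl⟩
      linarith [hneg x hx])
    obtain ⟨_, ⟨x, hx, rfl⟩, hlt⟩ :=
      exists_lt_of_csInf_lt (hne.image ψ) (lt_add_of_pos_right (sInf (ψ '' Ω)) hδ)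
    exact ⟨x, hx, by unfold osc; linarith⟩
  · have hinf : 0 ≤ sInf (ψ '' Ω) := Real.sInf_nonneg (by
      rintro _ ⟨x, hx, rfl⟩
      linarith [hneg x hx])
    obtain ⟨_, ⟨x, hx, rfl⟩, hlt⟩ :=
      exists_lt_of_lt_csSup (hne.image ψ) (sub_lt_self (sSup (ψ '' Ω)) hδ)
    exact ⟨x, hx, by unfold osc; linarith⟩

/-- Theorem 2.6 / `thm-Lambda1`: if `ψ₀` does not change sign in `Ω`
then `lim_{h→0⁺} h·log Λ^D(h,B,Ω) = −2·Osc_Ω ψ₀`. -/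
theorem pauli_full_lim_of_constant_sign (Ω : Set (ℝ × ℝ)) (B ψ₀ : ℝ × ℝ → ℝ)
    (hR : AssumptionR Ω B) (hsc : SimplyConnectedSpace Ω)
    (hψ : IsScalarPotential Ω B ψ₀)
    (hsign : (∀ x ∈ Ω, ψ₀ x < 0) ∨ (∀ x ∈ Ω, 0 < ψ₀ x)) :
    Tendsto (fun h : ℝ => h * Real.log (LambdaD h (perpGrad ψ₀) B Ω)) (𝓝[>] 0)
      (𝓝 (-(2 * osc ψ₀ Ω))) := by
  have hΩ := hR.isOpen
  obtain ⟨⟨x₀, hx₀⟩⟩ : Nonempty Ω := inferInstance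
  have hne : Ω.Nonempty := ⟨x₀, hx₀⟩
  obtain ⟨s, hs, hneg⟩ : ∃ s : ℝ, (s = 1 ∨ s = -1) ∧ ∀ x ∈ Ω, s * ψ₀ x < 0 := by
    rcases hsign with h | h
    · exact ⟨1, Or.inl rfl, fun x hx => by linarith [h x hx]⟩
    · exact ⟨-1, Or.inr rfl, fun x hx => by linarith [h x hx]⟩
  obtain ⟨R, hR0, hRb⟩ := hR.bounded.exists_pos_norm_le
  have hR1 : ∀ x ∈ Ω, |x.1| ≤ R := fun x hx => (norm_fst_le x).trans (hRb x hx)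
  have hbdd := hR.bounded.isCompact_closure.image_of_continuousOn hψ.contOn
  have hm : ∀ x ∈ Ω, sInf (ψ₀ '' Ω) ≤ ψ₀ x := fun x hx =>
    csInf_le (hbdd.bddBelow.mono (image_mono subset_closure)) (mem_image_of_mem _ hx)
  have hM : ∀ x ∈ Ω, ψ₀ x ≤ sSup (ψ₀ '' Ω) := fun x hx =>
    le_csSup (hbdd.bddAbove.mono (image_mono subset_closure)) (mem_image_of_mem _ hx)
  refine tendsto_mul_log_of_exp_bounds (c := 1 / (4 * R ^ 2)) (by positivity)
    (fun h hh => ?_) (fun δ hδ => ?_)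
  · have := le_LambdaD hΩ hψ.c2 hψ.lap_eq (nonempty_isTestFun hΩ hne) hR0 hR1 hm hM hh
    rw [neg_div, one_div_mul_eq_div]
    exact this
  · have hδ8 : 0 < δ / 8 := by positivity
    obtain ⟨C, hC, hCh⟩ := exists_isTestFun_pauliRayleigh_le hs hΩ hR.bounded hψ hneg hδ8
      (exists_mul_lt_neg_osc_sub hs hne hneg hδ8)
    refine ⟨C, hC, fun h hh => ?_⟩
    obtain ⟨u, hu, hle⟩ := hCh h hh
    rw [mul_div_cancel₀ δ (by norm_num : (8 : ℝ) ≠ 0)] at hle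
    exact (LambdaD_le_pauliRayleigh hΩ hψ.c2 hψ.lap_eq hR0 hR1 hm hM hh hs hu).trans hle
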